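/- Monotonicity of the information functional in the plane: for planar convex bodies A and T (compact convex sets with nonempty interior), I(A+T) ≥ I(A), where I(K) = area(K)/perimeter(K) and A+T is the Minkowski sum. -/

import Mathlib

open MeasureTheory Pointwise

/-- The area of a subset of the plane. -/
noncomputable def area (K : Set (EuclideanSpace ℝ (Fin 2))) : ℝ := (volume K).toReal

/-- The perimeter of a planar set: the one-dimensional Hausdorff measure
of its topological boundary. -/
noncomputable def perim (K : Set (EuclideanSpace ℝ (Fin 2))) : ℝ :=
  (μH[1] (frontier K)).toReal

/-- The information functional `I(K) = area(K)/perimeter(K)`. -/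
noncomputable def info (K : Set (EuclideanSpace ℝ (Fin 2))) : ℝ := area K / perim K

namespace PlanarConvex

/-- The Euclidean plane. -/
local notation "Plane" => EuclideanSpace ℝ (Fin 2)

/-! ### Coordinates -/

lemma inner_eq (u v : Plane) : inner ℝ u v = u 0 * v 0 + u 1 * v 1 := by
  simp [PiLp.inner_apply, Fin.sum_univ_two, mul_comm]

lemma sq_add_sq_of_norm_eq_one {u : Plane} (hu : ‖u‖ = 1) : u 0 ^ 2 + u 1 ^ 2 = 1 := by
  have h := inner_eq u u
  rw [real_inner_self_eq_norm_sq, hu] at h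
  linarith

/-- Rotation of the plane by a right angle. -/
noncomputable def rot (u : Plane) : Plane := !₂[-u 1, u 0]

@[simp] lemma rot_apply_zero (u : Plane) : rot u 0 = -u 1 := by simp [rot]

@[simp] lemma rot_apply_one (u : Plane) : rot u 1 = u 0 := by simp [rot]

lemma inner_rot_self (u : Plane) : inner ℝ u (rot u) = 0 := by
  rw [inner_eq, rot_apply_zero, rot_apply_one]; ring

lemma norm_rot {u : Plane} (hu : ‖u‖ = 1) : ‖rot u‖ = 1 := by
  have h := inner_eq (rot u) (rot u)
  rw [real_inner_self_eq_norm_sq, rot_apply_zero, rot_apply_one] at h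
  have h2 := sq_add_sq_of_norm_eq_one hu
  have : ‖rot u‖ ^ 2 = 1 := by linarith
  nlinarith [norm_nonneg (rot u)]

lemma decomp_rot {u : Plane} (hu : ‖u‖ = 1) (x : Plane) :
    x = inner ℝ u x • u + inner ℝ (rot u) x • rot u := by
  have h := sq_add_sq_of_norm_eq_one hu
  rw [inner_eq, inner_eq]
  ext i
  fin_cases i
  · simp
    linear_combination -(x 0) * h
  · simp
    linear_combination -(x 1) * h

lemma eq_zero_of_inner_eq_zero {u v w : Plane} (hu : ‖u‖ = 1) (hv : ‖v‖ = 1) (huv : u ≠ v)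
    (huv' : u ≠ -v) (h1 : inner ℝ u w = 0) (h2 : inner ℝ v w = 0) : w = 0 := by
  rw [decomp_rot hu w, h1, inner_add_right, inner_smul_right, inner_smul_right] at h2
  rw [decomp_rot hu w, h1]
  simp only [zero_mul, zero_add, mul_eq_zero] at h2
  rcases h2 with h2 | h2
  · simp [h2]
  · exfalso
    have h3 := decomp_rot hu v
    rw [real_inner_comm, real_inner_comm v, h2, zero_smul, add_zero] at h3
    have h4 : ‖v‖ = ‖inner ℝ v u • u‖ := congrArg _ h3
    rw [norm_smul, hu, hv, mul_one, Real.norm_eq_abs] at h4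
    rcases eq_or_eq_neg_of_abs_eq h4.symm with h5 | h5
    · exact huv (by rw [h3, h5, one_smul])
    · exact huv' (by rw [h3, h5, neg_one_smul, neg_neg])

/-! ### Parallelograms and lines -/

/-- The parallelogram with vertex `p` and sides `v`, `w`. -/
def parallelogram (p v w : Plane) : Set Plane :=
  (fun z : ℝ × ℝ => p + (z.1 • v + z.2 • w)) '' (Set.Icc 0 1 ×ˢ Set.Icc 0 1)

lemma isCompact_parallelogram (p v w : Plane) : IsCompact (parallelogram p v w) :=
  (isCompact_Icc.prod isCompact_Icc).image (by fun_prop)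

lemma volume_parallelogram (p v w : Plane) :
    volume (parallelogram p v w) = ENNReal.ofReal |v 0 * w 1 - v 1 * w 0| := by
  set f : Plane →ₗ[ℝ] Plane :=
    (EuclideanSpace.basisFun (Fin 2) ℝ).toBasis.constr ℝ ![v, w] with hf
  have h1 : parallelogram p v w =
      (fun x => p + x) '' (f '' parallelepiped (EuclideanSpace.basisFun (Fin 2) ℝ)) := by
    have hb : ∀ i, f (EuclideanSpace.basisFun (Fin 2) ℝ i) = ![v, w] i := fun i => by
      have := (EuclideanSpace.basisFun (Fin 2) ℝ).toBasis.constr_basis ℝ ![v, w] i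
      rwa [OrthonormalBasis.coe_toBasis] at this
    rw [image_parallelepiped]
    have : (f ∘ (EuclideanSpace.basisFun (Fin 2) ℝ)) = ![v, w] := funext hb
    rw [this]
    ext x
    simp only [parallelogram, parallelepiped, Set.mem_image, Set.mem_prod, Set.mem_Icc,
      Fin.sum_univ_two, Matrix.cons_val_zero, Matrix.cons_val_one, Prod.exists]
    constructor
    · rintro ⟨a, b, ⟨⟨ha, ha'⟩, hb, hb'⟩, rfl⟩
      refine ⟨a • v + b • w, ⟨![a, b], ⟨?_, ?_⟩, by simp⟩, rfl⟩ <;>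
      · intro i; fin_cases i <;> simp [*]
    · rintro ⟨_, ⟨t, ⟨h0, h1⟩, rfl⟩, rfl⟩
      exact ⟨t 0, t 1, ⟨⟨h0 0, h1 0⟩, h0 1, h1 1⟩, rfl⟩
  have hdet : LinearMap.det f = v 0 * w 1 - v 1 * w 0 := by
    rw [← LinearMap.det_toMatrix (EuclideanSpace.basisFun (Fin 2) ℝ).toBasis, Matrix.det_fin_two]
    simp only [LinearMap.toMatrix_apply, hf, Module.Basis.constr_basis]
    simp
    ring
  rw [h1, Set.image_add_left, measure_preimage_add, Measure.addHaar_image_linearMap,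
    OrthonormalBasis.volume_parallelepiped, hdet, mul_one]

lemma volume_line (x w : Plane) : volume (Set.range fun s : ℝ => x + s • w) = 0 := by
  have h : (Set.range fun s : ℝ => x + s • w) =
      (fun y => x + y) '' (Submodule.span ℝ {w} : Set Plane) := by
    ext y
    simp [Submodule.mem_span_singleton, eq_neg_add_iff_add_eq]
  rw [h, Set.image_add_left, measure_preimage_add]
  refine Measure.addHaar_submodule _ _ fun htop => ?_
  have h1 := finrank_span_le_card (R := ℝ) ({w} : Set Plane)
  rw [htop, finrank_top, finrank_euclideanSpace_fin] at h1
  simp at h1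

/-! ### Support lines and monotonicity of the perimeter -/

lemma exists_support {K : Set Plane} (hK : Convex ℝ K) (hK_int : (interior K).Nonempty)
    {x : Plane} (hx : x ∉ interior K) :
    ∃ u : Plane, ‖u‖ = 1 ∧ ∀ w ∈ K, inner ℝ u w ≤ inner ℝ u x := by
  obtain ⟨f, hf⟩ := geometric_hahn_banach_open_point hK.interior isOpen_interior hx
  set v : Plane := (InnerProductSpace.toDual ℝ Plane).symm f with hv
  have hfv : ∀ y, f y = inner ℝ v y := fun y => by
    rw [hv, InnerProductSpace.toDual_symm_apply]
  have hv0 : v ≠ 0 := by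
    rintro h0
    obtain ⟨y, hy⟩ := hK_int
    have := hf y hy
    rw [hfv, hfv, h0] at this
    simp at this
  have hle : ∀ w ∈ K, inner ℝ v w ≤ inner ℝ v x := by
    have hcl : IsClosed {w : Plane | inner ℝ v w ≤ inner ℝ v x} :=
      isClosed_le (by fun_prop) (by fun_prop)
    have hsub : interior K ⊆ {w : Plane | inner ℝ v w ≤ inner ℝ v x} := fun w hw => by
      have := hf w hw
      rw [hfv, hfv] at this
      exact this.le
    intro w hw
    have := hcl.closure_subset_iff.2 hsub
    rw [hK.closure_interior_eq_closure_of_nonempty_interior hK_int] at this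
    exact this (subset_closure hw)
  refine ⟨‖v‖⁻¹ • v, ?_, fun w hw => ?_⟩
  · rw [norm_smul, norm_inv, norm_norm, inv_mul_cancel₀ (norm_ne_zero_iff.2 hv0)]
  · rw [real_inner_smul_left, real_inner_smul_left]
    exact mul_le_mul_of_nonneg_left (hle w hw) (by positivity)

lemma exists_proj {K : Set Plane} (hK : Convex ℝ K) (hKc : IsCompact K) (hne : K.Nonempty)
    (x : Plane) : ∃ y ∈ K, ∀ w ∈ K, inner ℝ (x - y) (w - y) ≤ 0 := by
  obtain ⟨y, hy, h⟩ := exists_norm_eq_iInf_of_complete_convex hne hKc.isComplete hK x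
  exact ⟨y, hy, (norm_eq_iInf_iff_real_inner_le_zero hK hy).1 h⟩

/-- A ray starting in a compact set `L` meets the frontier of `L`. -/
lemma exists_ray_mem_frontier {L : Set Plane} (hL : IsCompact L) {x u : Plane} (hx : x ∈ L)
    (hu : u ≠ 0) : ∃ s : ℝ, 0 ≤ s ∧ x + s • u ∈ frontier L := by
  set S : Set ℝ := Set.Ici 0 ∩ (fun s : ℝ => x + s • u) ⁻¹' L with hS
  have hcont : Continuous fun s : ℝ => x + s • u := by fun_prop
  have hScl : IsClosed S := isClosed_Ici.inter (hL.isClosed.preimage hcont)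
  have hupos : 0 < ‖u‖ := norm_pos_iff.2 hu
  obtain ⟨R, hR⟩ := hL.isBounded.exists_norm_le
  have hbdd : BddAbove S := by
    refine ⟨(R + ‖x‖) / ‖u‖, ?_⟩
    rintro s ⟨hs0, hs⟩
    rw [le_div_iff₀ hupos]
    have h1 := hR _ hs
    have h2 : ‖s • u‖ ≤ ‖x + s • u‖ + ‖x‖ := by
      have := norm_sub_le (x + s • u) x
      rwa [add_sub_cancel_left] at this
    rw [norm_smul, Real.norm_of_nonneg hs0] at h2
    linarith
  have hne : S.Nonempty := ⟨0, Set.mem_Ici.2 le_rfl, by simpa using hx⟩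
  have hmem := hScl.csSup_mem hne hbdd
  refine ⟨sSup S, hmem.1, subset_closure hmem.2, fun hK_int => ?_⟩
  have hopen := (isOpen_interior (s := L)).preimage hcont
  obtain ⟨ε, hε, hball⟩ := Metric.isOpen_iff.1 hopen (sSup S) hK_int
  have hin : sSup S + ε / 2 ∈ S := by
    suffices hd : sSup S + ε / 2 ∈ Metric.ball (sSup S) ε from
      ⟨add_nonneg (Set.mem_Ici.1 hmem.1) (half_pos hε).le, interior_subset (s := L) (hball hd)⟩
    rw [Metric.mem_ball, Real.dist_eq, add_sub_cancel_left, abs_of_pos (by positivity)]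
    linarith
  have := le_csSup hbdd hin
  linarith

theorem hausdorffMeasure_frontier_mono {K L : Set Plane} (hK : Convex ℝ K) (hKc : IsCompact K)
    (hK_int : (interior K).Nonempty) (hL : IsCompact L) (hKL : K ⊆ L) :
    μH[1] (frontier K) ≤ μH[1] (frontier L) := by
  choose p hpK hp using exists_proj hK hKc (hK_int.mono interior_subset)
  have hlip : LipschitzWith 1 p := by
    refine LipschitzWith.of_dist_le_mul fun x y => ?_
    rw [NNReal.coe_one, one_mul, dist_eq_norm, dist_eq_norm]
    have h1 := hp x (p y) (hpK y)
    have h2 := hp y (p x) (hpK x)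
    have h3 : inner ℝ (p x - p y) (p x - p y) ≤ inner ℝ (x - y) (p x - p y) := by
      simp only [inner_sub_left, inner_sub_right] at h1 h2 ⊢
      linarith
    rw [real_inner_self_eq_norm_sq] at h3
    have h4 := real_inner_le_norm (x - y) (p x - p y)
    rcases (norm_nonneg (p x - p y)).eq_or_lt with h0 | h0
    · rw [← h0]; positivity
    · nlinarith
  have hsub : frontier K ⊆ p '' frontier L := by
    intro x hx
    have hxK : x ∈ K := hKc.isClosed.frontier_subset hx
    obtain ⟨u, hu1, hu⟩ := exists_support hK hK_int hx.2
    have hu0 : u ≠ 0 := norm_ne_zero_iff.1 (by rw [hu1]; exact one_ne_zero)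
    obtain ⟨s, hs, hsL⟩ := exists_ray_mem_frontier hL (hKL hxK) hu0
    refine ⟨_, hsL, ?_⟩
    have h1 := hp (x + s • u) x hxK
    have h2 := mul_le_mul_of_nonneg_left (hu _ (hpK (x + s • u))) hs
    set q := p (x + s • u)
    have h3 : inner ℝ (q - x) (q - x) ≤ 0 := by
      simp only [inner_sub_left, inner_sub_right, inner_add_left, real_inner_smul_left] at h1 ⊢
      have := real_inner_comm q x
      linarith
    exact sub_eq_zero.1 (real_inner_self_nonpos.1 h3)
  calc μH[1] (frontier K) ≤ μH[1] (p '' frontier L) := measure_mono hsub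
    _ ≤ _ := by simpa using hlip.hausdorffMeasure_image_le zero_le_one (frontier L)

/-! ### Circumscribed polygons -/

/-- A bounded polygon cut out by half-planes with outer unit normals in `N`, each of which
supports the polygon, together with a parametrization of its (possibly degenerate) edges. -/
structure Polygon (N : Finset Plane) (A : Set Plane) where
  /-- The support function. -/
  supp : Plane → ℝ
  /-- The first endpoint of the edge with a given normal. -/
  start : Plane → Plane
  /-- The length of the edge with a given normal. -/
  len : Plane → ℝ
  isCompact : IsCompact A
  norm_eq : ∀ u ∈ N, ‖u‖ = 1
  mem_iff : ∀ x, x ∈ A ↔ ∀ u ∈ N, inner ℝ u x ≤ supp u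
  exists_lt : ∃ x ∈ A, ∀ u ∈ N, inner ℝ u x < supp u
  len_nonneg : ∀ u, 0 ≤ len u
  face_eq : ∀ u ∈ N, {x | x ∈ A ∧ inner ℝ u x = supp u} =
    segment ℝ (start u) (start u + len u • rot u)

lemma exists_face_eq_segment {A : Set Plane} (hA : Convex ℝ A) (hAc : IsCompact A) {u : Plane}
    (hu : ‖u‖ = 1) {c : ℝ} (hne : ∃ x ∈ A, inner ℝ u x = c) :
    ∃ p : Plane, ∃ l : ℝ, 0 ≤ l ∧
      {x | x ∈ A ∧ inner ℝ u x = c} = segment ℝ p (p + l • rot u) := by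
  set F : Set Plane := {x | x ∈ A ∧ inner ℝ u x = c} with hF
  have hFc : IsCompact F := hAc.inter_right (isClosed_eq (by fun_prop) continuous_const)
  have hFconv : Convex ℝ F := by
    rintro x ⟨hx, hxc⟩ y ⟨hy, hyc⟩ a b ha hb hab
    refine ⟨hA hx hy ha hb hab, ?_⟩
    rw [inner_add_right, inner_smul_right, inner_smul_right, hxc, hyc, ← add_mul, hab, one_mul]
  have hcont : ContinuousOn (fun x : Plane => inner ℝ (rot u) x) F := by fun_prop
  obtain ⟨p, hp, hpmin⟩ := hFc.exists_isMinOn hne hcont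
  obtain ⟨q, hq, hqmax⟩ := hFc.exists_isMaxOn hne hcont
  replace hpmin : ∀ x ∈ F, inner ℝ (rot u) p ≤ inner ℝ (rot u) x := fun x hx => hpmin hx
  replace hqmax : ∀ x ∈ F, inner ℝ (rot u) x ≤ inner ℝ (rot u) q := fun x hx => hqmax hx
  have key : ∀ x ∈ F, x = p + (inner ℝ (rot u) x - inner ℝ (rot u) p) • rot u := by
    intro x hx
    have h1 := decomp_rot hu x
    have h2 := decomp_rot hu p
    rw [hx.2] at h1
    rw [hp.2] at h2
    calc x = _ := h1
      _ = (c • u + inner ℝ (rot u) p • rot u) +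
          (inner ℝ (rot u) x - inner ℝ (rot u) p) • rot u := by rw [sub_smul]; abel
      _ = _ := by rw [← h2]
  refine ⟨p, inner ℝ (rot u) q - inner ℝ (rot u) p, sub_nonneg.2 (hpmin q hq), ?_⟩
  rw [← key q hq]
  refine Set.Subset.antisymm (fun x hx => ?_) (hFconv.segment_subset hp hq)
  rcases (sub_nonneg.2 (hpmin q hq)).eq_or_lt with h0 | h0
  · have h1 : inner ℝ (rot u) x - inner ℝ (rot u) p = 0 :=
      le_antisymm (by linarith [hqmax x hx])
        (sub_nonneg.2 (hpmin x hx))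
    rw [key x hx, h1, zero_smul, add_zero]
    exact left_mem_segment ℝ p q
  · rw [segment_eq_image']
    refine ⟨(inner ℝ (rot u) x - inner ℝ (rot u) p) / (inner ℝ (rot u) q - inner ℝ (rot u) p),
      ⟨div_nonneg (sub_nonneg.2 (hpmin x hx)) h0.le, ?_⟩, ?_⟩
    · rw [div_le_one h0]
      exact sub_le_sub_right (hqmax x hx) _
    · have h1 : q - p = (inner ℝ (rot u) q - inner ℝ (rot u) p) • rot u := by
        rw [sub_eq_iff_eq_add']; exact key q hq
      have h2 := key x hx
      simp only
      rw [h1, smul_smul, div_mul_cancel₀ _ (ne_of_gt h0), ← h2]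

lemma notMem_interior_of_forall_inner_le {A : Set Plane} {a w : Plane} (hw : ‖w‖ = 1)
    (h : ∀ x ∈ A, inner ℝ w x ≤ inner ℝ w a) : a ∉ interior A := by
  intro ha
  obtain ⟨ε, hε, hball⟩ := Metric.isOpen_iff.1 isOpen_interior a ha
  have hmem : a + (ε / 2) • w ∈ Metric.ball a ε := by
    rw [mem_ball_iff_norm, add_sub_cancel_left, norm_smul, hw, mul_one,
      Real.norm_of_nonneg (by positivity)]
    linarith
  have := h _ (interior_subset (hball hmem))
  rw [inner_add_right, inner_smul_right, real_inner_self_eq_norm_sq, hw] at this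
  linarith

namespace Polygon

variable {N : Finset Plane} {A T : Set Plane}

/-- The edge of a polygon with outer normal `u`. -/
def face (P : Polygon N A) (u : Plane) : Set Plane := {x | x ∈ A ∧ inner ℝ u x = P.supp u}

/-- The second endpoint of the edge with normal `u`. -/
noncomputable def endpt (P : Polygon N A) (u : Plane) : Plane := P.start u + P.len u • rot u

/-- The sum of the edge lengths. -/
noncomputable def per (P : Polygon N A) : ℝ := ∑ u ∈ N, P.len u

lemma face_eq_segment (P : Polygon N A) {u : Plane} (hu : u ∈ N) :
    P.face u = segment ℝ (P.start u) (P.endpt u) := P.face_eq u hu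

lemma start_mem (P : Polygon N A) {u : Plane} (hu : u ∈ N) : P.start u ∈ P.face u := by
  rw [P.face_eq_segment hu]; exact left_mem_segment ..

lemma endpt_mem (P : Polygon N A) {u : Plane} (hu : u ∈ N) : P.endpt u ∈ P.face u := by
  rw [P.face_eq_segment hu]; exact right_mem_segment ..

lemma mem_face_iff (P : Polygon N A) {u : Plane} (hu : u ∈ N) {x : Plane} :
    x ∈ P.face u ↔ ∃ s ∈ Set.Icc (0 : ℝ) 1, P.start u + (s * P.len u) • rot u = x := by
  rw [P.face_eq_segment hu, segment_eq_image']
  simp [endpt, smul_smul]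

lemma inner_rot_start_le (P : Polygon N A) {u : Plane} (hu : u ∈ N) {x : Plane}
    (hx : x ∈ P.face u) : inner ℝ (rot u) (P.start u) ≤ inner ℝ (rot u) x := by
  obtain ⟨s, ⟨hs, -⟩, rfl⟩ := (P.mem_face_iff hu).1 hx
  rw [inner_add_right, inner_smul_right, real_inner_self_eq_norm_sq]
  have := mul_nonneg (mul_nonneg hs (P.len_nonneg u)) (sq_nonneg ‖rot u‖)
  linarith

lemma inner_rot_le_endpt (P : Polygon N A) {u : Plane} (hu : u ∈ N) {x : Plane}
    (hx : x ∈ P.face u) : inner ℝ (rot u) x ≤ inner ℝ (rot u) (P.endpt u) := by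
  obtain ⟨s, ⟨-, hs⟩, rfl⟩ := (P.mem_face_iff hu).1 hx
  rw [endpt, inner_add_right, inner_smul_right, inner_add_right, inner_smul_right,
    real_inner_self_eq_norm_sq]
  have := mul_nonneg (mul_nonneg (sub_nonneg.2 hs) (P.len_nonneg u)) (sq_nonneg ‖rot u‖)
  linarith

lemma per_nonneg (P : Polygon N A) : 0 ≤ P.per := Finset.sum_nonneg fun u _ => P.len_nonneg u

lemma inner_le (P : Polygon N A) {u x : Plane} (hu : u ∈ N) (hx : x ∈ A) :
    inner ℝ u x ≤ P.supp u := (P.mem_iff x).1 hx u hu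

lemma convex (P : Polygon N A) : Convex ℝ A := by
  intro x hx y hy a b ha hb hab
  refine (P.mem_iff _).2 fun u hu => ?_
  rw [inner_add_right, inner_smul_right, inner_smul_right]
  calc a * inner ℝ u x + b * inner ℝ u y ≤ a * P.supp u + b * P.supp u := by
        gcongr
        · exact P.inner_le hu hx
        · exact P.inner_le hu hy
    _ = P.supp u := by rw [← add_mul, hab, one_mul]

lemma mem_interior_of_lt (P : Polygon N A) {x : Plane} (hx : ∀ u ∈ N, inner ℝ u x < P.supp u) :
    x ∈ interior A := by
  have hopen : IsOpen (⋂ u ∈ N, {y : Plane | inner ℝ u y < P.supp u}) :=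
    isOpen_biInter_finset fun u _ => isOpen_lt (by fun_prop) continuous_const
  refine mem_interior.2 ⟨_, fun y hy => (P.mem_iff y).2 fun u hu => ?_, hopen, ?_⟩
  · exact (Set.mem_iInter₂.1 hy u hu).le
  · exact Set.mem_iInter₂.2 hx

lemma interior_nonempty (P : Polygon N A) : (interior A).Nonempty := by
  obtain ⟨x, -, hx⟩ := P.exists_lt
  exact ⟨x, P.mem_interior_of_lt hx⟩

lemma exists_mem_face (P : Polygon N A) {x : Plane} (hx : x ∈ A) (hxi : x ∉ interior A) :
    ∃ u ∈ N, x ∈ P.face u := by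
  by_contra! h
  exact hxi (P.mem_interior_of_lt fun u hu =>
    lt_of_le_of_ne (P.inner_le hu hx) fun he => h u hu ⟨hx, he⟩)

lemma face_subset_frontier (P : Polygon N A) {u : Plane} (hu : u ∈ N) :
    P.face u ⊆ frontier A := fun x hx =>
  ⟨subset_closure hx.1, notMem_interior_of_forall_inner_le (P.norm_eq u hu) fun y hy => by
    rw [hx.2]; exact P.inner_le hu hy⟩

lemma frontier_eq (P : Polygon N A) : frontier A = ⋃ u ∈ N, P.face u := by
  refine Set.Subset.antisymm (fun x hx => ?_) (Set.iUnion₂_subset fun u hu =>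
    P.face_subset_frontier hu)
  obtain ⟨u, hu, h⟩ := P.exists_mem_face (P.isCompact.isClosed.frontier_subset hx) hx.2
  exact Set.mem_iUnion₂.2 ⟨u, hu, h⟩

lemma face_inter_subsingleton (P : Polygon N A) {u v : Plane} (hu : u ∈ N) (hv : v ∈ N)
    (huv : u ≠ v) : (P.face u ∩ P.face v).Subsingleton := by
  rintro x ⟨⟨hxA, hxu⟩, -, hxv⟩ y ⟨⟨-, hyu⟩, -, hyv⟩
  refine sub_eq_zero.1 (eq_zero_of_inner_eq_zero (P.norm_eq u hu) (P.norm_eq v hv) huv ?_ ?_ ?_)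
  · rintro rfl
    obtain ⟨o, -, ho⟩ := P.exists_lt
    have h1 := ho _ hu
    have h2 := ho _ hv
    rw [inner_neg_left] at h1 hxu
    linarith
  · rw [inner_sub_right, hxu, hyu, sub_self]
  · rw [inner_sub_right, hxv, hyv, sub_self]

lemma isCompact_face (P : Polygon N A) (u : Plane) : IsCompact (P.face u) :=
  P.isCompact.inter_right (isClosed_eq (by fun_prop) continuous_const)

lemma hausdorffMeasure_segment_rot {u : Plane} (hu : ‖u‖ = 1) (p : Plane) {l : ℝ} (hl : 0 ≤ l) :
    μH[1] (segment ℝ p (p + l • rot u)) = ENNReal.ofReal l := by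
  rw [hausdorffMeasure_segment, edist_dist, dist_eq_norm, sub_add_cancel_left, norm_neg,
    norm_smul, norm_rot hu, mul_one, Real.norm_of_nonneg hl]

theorem hausdorffMeasure_frontier (P : Polygon N A) :
    μH[1] (frontier A) = ENNReal.ofReal P.per := by
  rw [P.frontier_eq, measure_biUnion_finset₀, per,
    ENNReal.ofReal_sum_of_nonneg fun u _ => P.len_nonneg u]
  · refine Finset.sum_congr rfl fun u hu => ?_
    rw [P.face_eq_segment hu]
    exact hausdorffMeasure_segment_rot (P.norm_eq u hu) _ (P.len_nonneg u)
  · intro u hu v hv huv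
    have := Measure.nullSingletonClass_hausdorff Plane one_pos
    exact (P.face_inter_subsingleton hu hv huv).measure_zero _
  · exact fun u _ => (P.isCompact_face u).measurableSet.nullMeasurableSet

lemma normals_nonempty (P : Polygon N A) : N.Nonempty := by
  by_contra h
  rw [Finset.not_nonempty_iff_eq_empty] at h
  subst h
  have : A = Set.univ := Set.eq_univ_of_forall fun x => (P.mem_iff x).2 (by simp)
  exact noncompact_univ Plane (this ▸ P.isCompact)

/-- The area of a polygon is at most its inradius times its perimeter. -/
theorem exists_inradius (P : Polygon N A) : ∃ o ∈ A, ∃ r : ℝ, 0 < r ∧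
    (∀ u ∈ N, r ≤ P.supp u - inner ℝ u o) ∧ volume A ≤ ENNReal.ofReal (r * P.per) := by
  have hN := P.normals_nonempty
  obtain ⟨z, hzA, hz⟩ := P.exists_lt
  have hcont : Continuous fun x : Plane => N.inf' hN fun u => P.supp u - inner ℝ u x :=
    Continuous.finset_inf'_apply hN fun u _ => by fun_prop
  obtain ⟨o, hoA, ho⟩ := P.isCompact.exists_isMaxOn ⟨z, hzA⟩ hcont.continuousOn
  set r := N.inf' hN fun u => P.supp u - inner ℝ u o with hr
  have hrpos : 0 < r := by
    refine lt_of_lt_of_le ?_ (ho hzA)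
    exact (Finset.lt_inf'_iff hN).2 fun u hu => sub_pos.2 (hz u hu)
  refine ⟨o, hoA, r, hrpos, fun u hu => Finset.inf'_le _ hu, ?_⟩
  have hcover : A ⊆ ⋃ u ∈ N,
      parallelogram (P.start u) (P.len u • rot u) ((-r) • u) := by
    intro x hx
    obtain ⟨u, hu, hmin⟩ := N.exists_mem_eq_inf' hN fun u => P.supp u - inner ℝ u x
    set d := P.supp u - inner ℝ u x with hd
    have hd0 : 0 ≤ d := sub_nonneg.2 (P.inner_le hu hx)
    have hdr : d ≤ r := by rw [← hmin]; exact ho hx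
    have hface : x + d • u ∈ P.face u := by
      refine ⟨(P.mem_iff _).2 fun v hv => ?_, ?_⟩
      · have h1 : d ≤ P.supp v - inner ℝ v x := by rw [← hmin]; exact Finset.inf'_le _ hv
        have h2 : inner ℝ v u ≤ 1 := by
          have := real_inner_le_norm v u
          rwa [P.norm_eq u hu, P.norm_eq v hv, one_mul] at this
        rw [inner_add_right, inner_smul_right]
        nlinarith
      · rw [inner_add_right, inner_smul_right, real_inner_self_eq_norm_sq, P.norm_eq u hu]
        linarith
    obtain ⟨s, hs, hsx⟩ := (P.mem_face_iff hu).1 hface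
    refine Set.mem_iUnion₂.2 ⟨u, hu, (s, d / r),
      ⟨hs, div_nonneg hd0 hrpos.le, (div_le_one hrpos).2 hdr⟩, ?_⟩
    simp only [smul_smul]
    rw [← add_assoc, hsx, mul_neg, div_mul_cancel₀ _ hrpos.ne', neg_smul, add_neg_cancel_right]
  refine (measure_mono hcover).trans ((measure_biUnion_finset_le _ _).trans ?_)
  rw [per, Finset.mul_sum, ENNReal.ofReal_sum_of_nonneg fun u _ =>
    mul_nonneg hrpos.le (P.len_nonneg u)]
  refine Finset.sum_le_sum fun u hu => ?_
  rw [volume_parallelogram]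
  refine ENNReal.ofReal_le_ofReal (le_of_eq ?_)
  have h := sq_add_sq_of_norm_eq_one (P.norm_eq u hu)
  have h1 : (P.len u • rot u) 0 * ((-r) • u) 1 - (P.len u • rot u) 1 * ((-r) • u) 0 =
      r * P.len u := by
    simp
    linear_combination (r * P.len u) * h
  rw [h1, abs_of_nonneg (mul_nonneg hrpos.le (P.len_nonneg u))]

/-- The union of all dilates `t + [o, a]` with `t`, `a` on parallel edges of two polygons. -/
def sector (P : Polygon N A) (Q : Polygon N T) (o u : Plane) : Set Plane :=
  {p | ∃ t ∈ Q.face u, ∃ a ∈ P.face u, ∃ s ∈ Set.Icc (0 : ℝ) 1, p = t + (o + s • (a - o))}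

lemma volume_sector_inter (P : Polygon N A) (Q : Polygon N T) {o : Plane}
    (ho : ∀ u ∈ N, inner ℝ u o < P.supp u) {u v : Plane} (hu : u ∈ N) (hv : v ∈ N)
    (huv : u ≠ v) : volume (P.sector Q o u ∩ P.sector Q o v) = 0 := by
  have hsub := P.face_inter_subsingleton hu hv huv
  have hsub' := Q.face_inter_subsingleton hu hv huv
  obtain ⟨x, hx⟩ : ∃ x, ∀ y ∈ Q.face u ∩ Q.face v, y = x := by
    rcases hsub'.eq_empty_or_singleton with h | ⟨x, h⟩ <;> simp [h]
  obtain ⟨y, hy⟩ : ∃ y, ∀ z ∈ P.face u ∩ P.face v, z = y := by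
    rcases hsub.eq_empty_or_singleton with h | ⟨y, h⟩ <;> simp [h]
  -- The scale of a point of a sector is at most its scale in any other sector.
  have key : ∀ {u v : Plane}, u ∈ N → ∀ {t t' a a' : Plane} {s s' : ℝ},
      t ∈ Q.face u → t' ∈ Q.face v → a ∈ P.face u → a' ∈ P.face v → 0 ≤ s' →
      t + (o + s • (a - o)) = t' + (o + s' • (a' - o)) →
      s * (P.supp u - inner ℝ u o) = (inner ℝ u t' - Q.supp u) +
        s' * (inner ℝ u a' - P.supp u) + s' * (P.supp u - inner ℝ u o) ∧
      inner ℝ u t' - Q.supp u ≤ 0 ∧ s' * (inner ℝ u a' - P.supp u) ≤ 0 := by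
    intro u v hu t t' a a' s s' ht ht' ha ha' hs' h
    have h1 := congrArg (inner ℝ u) h
    simp only [inner_add_right, inner_smul_right, inner_sub_right, ht.2, ha.2] at h1
    refine ⟨by linarith, sub_nonpos.2 (Q.inner_le hu ht'.1),
      mul_nonpos_of_nonneg_of_nonpos hs' (sub_nonpos.2 (P.inner_le hu ha'.1))⟩
  refine measure_mono_null ?_ (volume_line (x + o) (y - o))
  rintro p ⟨⟨t, ht, a, ha, s, hs, hp⟩, t', ht', a', ha', s', hs', hp'⟩
  obtain ⟨k1, k2, k3⟩ := key hu ht ht' ha ha' hs'.1 (hp.symm.trans hp')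
  obtain ⟨l1, l2, l3⟩ := key hv ht' ht ha' ha hs.1 (hp'.symm.trans hp)
  have hou := sub_pos.2 (ho u hu)
  have hov := sub_pos.2 (ho v hv)
  have hss : s = s' := by
    refine le_antisymm (le_of_mul_le_mul_right ?_ hou) (le_of_mul_le_mul_right ?_ hov) <;>
    linarith
  subst hss
  have htx : t = x := hx t ⟨ht, ht.1, by linarith⟩
  refine ⟨s, ?_⟩
  rcases hs.1.eq_or_lt with h0 | h0
  · rw [hp, ← h0, htx]; simp
  · have hay : a = y := by
      refine hy a ⟨ha, ha.1, ?_⟩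
      have h1 : s * (inner ℝ v a - P.supp v) = 0 := by linarith
      rcases mul_eq_zero.1 h1 with h | h
      · exact absurd h h0.ne'
      · linarith
    rw [hp, htx, hay]
    simp only [add_assoc]

lemma sector_subset (P : Polygon N A) (Q : Polygon N T) {o : Plane} (ho : o ∈ A) (u : Plane) :
    P.sector Q o u ⊆ A + T := by
  rintro _ ⟨t, ht, a, ha, s, hs, rfl⟩
  rw [add_comm t]
  exact Set.add_mem_add (P.convex.add_smul_sub_mem ho ha.1 hs) ht.1

/-- The triangle spanned by `o` and the edge with normal `u`. -/
def cone (P : Polygon N A) (o u : Plane) : Set Plane :=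
  (fun z : ℝ × Plane => o + z.1 • (z.2 - o)) '' (Set.Icc 0 1 ×ˢ P.face u)

lemma isCompact_cone (P : Polygon N A) (o u : Plane) : IsCompact (P.cone o u) :=
  (isCompact_Icc.prod (P.isCompact_face u)).image (by fun_prop)

lemma subset_iUnion_cone (P : Polygon N A) {o : Plane}
    (ho : ∀ u ∈ N, inner ℝ u o < P.supp u) : A ⊆ ⋃ u ∈ N, P.cone o u := by
  intro x hx
  have hN := P.normals_nonempty
  rcases eq_or_ne x o with rfl | hxo
  · obtain ⟨u, hu⟩ := hN
    exact Set.mem_iUnion₂.2 ⟨u, hu, (0, P.start u), ⟨by simp, P.start_mem hu⟩, by simp⟩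
  have hoA : o ∈ A := (P.mem_iff o).2 fun u hu => (ho u hu).le
  -- Follow the ray from `o` through `x` to the frontier.
  obtain ⟨s, hs, hsA⟩ := exists_ray_mem_frontier P.isCompact hx (sub_ne_zero.2 hxo)
  obtain ⟨u, hu, hface⟩ := P.exists_mem_face (P.isCompact.isClosed.frontier_subset hsA) hsA.2
  have hs1 : 0 < 1 + s := by positivity
  refine Set.mem_iUnion₂.2 ⟨u, hu, ((1 + s)⁻¹, x + s • (x - o)),
    ⟨⟨(inv_pos.2 hs1).le, inv_le_one_of_one_le₀ (by linarith)⟩, hface⟩, ?_⟩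
  have h1 : x + s • (x - o) - o = (1 + s) • (x - o) := by
    rw [add_smul, one_smul]; abel
  simp only [h1]
  rw [smul_smul, inv_mul_cancel₀ hs1.ne', one_smul, add_sub_cancel]

lemma volume_sector_ge (P : Polygon N A) (Q : Polygon N T) {o : Plane}
    (ho : ∀ u ∈ N, inner ℝ u o < P.supp u) {u : Plane} (hu : u ∈ N) :
    ∃ S ⊆ P.sector Q o u, IsCompact S ∧ volume S =
      volume (P.cone o u) + ENNReal.ofReal ((P.supp u - inner ℝ u o) * Q.len u) := by
  set C := (fun x => Q.start u + x) '' P.cone o u with hC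
  set D := parallelogram (Q.start u + o) (Q.len u • rot u) (P.endpt u - o) with hD
  have hCc : IsCompact C := (P.isCompact_cone o u).image (by fun_prop)
  have hDc : IsCompact D := isCompact_parallelogram ..
  have hCvol : volume C = volume (P.cone o u) := by
    rw [hC, Set.image_add_left, measure_preimage_add]
  have hDvol : volume D = ENNReal.ofReal ((P.supp u - inner ℝ u o) * Q.len u) := by
    rw [hD, volume_parallelogram]
    have h1 := (P.endpt_mem hu).2
    rw [inner_eq] at h1
    have h2 : (Q.len u • rot u) 0 * (P.endpt u - o) 1 - (Q.len u • rot u) 1 * (P.endpt u - o) 0 =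
        -((P.supp u - inner ℝ u o) * Q.len u) := by
      rw [inner_eq]
      simp
      linear_combination (-Q.len u) * h1
    rw [h2, abs_neg, abs_of_nonneg (mul_nonneg (sub_pos.2 (ho u hu)).le (Q.len_nonneg u))]
  have hCD : volume (C ∩ D) = 0 := by
    refine measure_mono_null ?_ (volume_line (Q.start u + o) (P.endpt u - o))
    rintro p ⟨⟨_, ⟨⟨s, a⟩, ⟨hs, ha⟩, rfl⟩, hp⟩, ⟨⟨m, s'⟩, ⟨hm, hs'⟩, hp'⟩⟩
    simp only at hp hp' ha hs
    have heq : Q.start u + (o + s • (a - o)) =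
        Q.start u + o + (m • Q.len u • rot u + s' • (P.endpt u - o)) := hp.trans hp'.symm
    have hou := sub_pos.2 (ho u hu)
    have hss : s = s' := by
      have h1 := congrArg (inner ℝ u) heq
      simp only [inner_add_right, inner_smul_right, inner_sub_right, ha.2, (P.endpt_mem hu).2,
        inner_rot_self] at h1
      exact mul_right_cancel₀ hou.ne' (by linarith)
    subst hss
    have h2 := congrArg (inner ℝ (rot u)) heq
    simp only [inner_add_right, inner_smul_right, inner_sub_right,
      real_inner_self_eq_norm_sq, norm_rot (P.norm_eq u hu)] at h2
    have h3 := mul_nonneg hs.1 (sub_nonneg.2 (P.inner_rot_le_endpt hu ha))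
    have h4 := mul_nonneg hm.1 (Q.len_nonneg u)
    have h5 : m * Q.len u = 0 := by nlinarith
    refine ⟨s, ?_⟩
    rw [← hp']
    simp only
    rw [smul_smul, h5, zero_smul, zero_add]
  refine ⟨C ∪ D, Set.union_subset ?_ ?_, hCc.union hDc, ?_⟩
  · rintro _ ⟨_, ⟨⟨s, a⟩, ⟨hs, ha⟩, rfl⟩, rfl⟩
    exact ⟨_, Q.start_mem hu, a, ha, s, hs, rfl⟩
  · rintro _ ⟨⟨m, s⟩, ⟨hm, hs⟩, rfl⟩
    refine ⟨_, (Q.mem_face_iff hu).2 ⟨m, hm, rfl⟩, _, P.endpt_mem hu, s, hs, ?_⟩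
    simp only [smul_smul]
    abel
  · rw [measure_union₀ hDc.measurableSet.nullMeasurableSet hCD, hCvol, hDvol]

/-- Minkowski addition of `T` to a polygon `A` containing a disc of radius `r` increases the area
by at least `r` times the perimeter of `T`. -/
theorem volume_add_ge (P : Polygon N A) (Q : Polygon N T) {o : Plane} (hoA : o ∈ A) {r : ℝ}
    (hr : 0 < r) (hro : ∀ u ∈ N, r ≤ P.supp u - inner ℝ u o) :
    volume A + ENNReal.ofReal (r * Q.per) ≤ volume (A + T) := by
  have ho : ∀ u ∈ N, inner ℝ u o < P.supp u := fun u hu => by linarith [hro u hu]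
  have hS := fun u (hu : u ∈ N) => P.volume_sector_ge Q ho hu
  choose! S hSsub hSc hSvol using hS
  calc volume A + ENNReal.ofReal (r * Q.per)
      ≤ (∑ u ∈ N, volume (P.cone o u)) +
          ∑ u ∈ N, ENNReal.ofReal ((P.supp u - inner ℝ u o) * Q.len u) := by
        gcongr
        · exact (measure_mono (P.subset_iUnion_cone ho)).trans (measure_biUnion_finset_le _ _)
        · rw [per, Finset.mul_sum, ENNReal.ofReal_sum_of_nonneg fun u _ =>
            mul_nonneg hr.le (Q.len_nonneg u)]
          exact Finset.sum_le_sum fun u hu => ENNReal.ofReal_le_ofReal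
            (mul_le_mul_of_nonneg_right (hro u hu) (Q.len_nonneg u))
    _ = ∑ u ∈ N, volume (S u) := by
        rw [← Finset.sum_add_distrib]
        exact Finset.sum_congr rfl fun u hu => (hSvol u hu).symm
    _ = volume (⋃ u ∈ N, S u) := by
        rw [measure_biUnion_finset₀]
        · exact fun u hu v hv huv => measure_mono_null
            (Set.inter_subset_inter (hSsub u hu) (hSsub v hv))
            (P.volume_sector_inter Q ho hu hv huv)
        · exact fun u hu => (hSc u hu).measurableSet.nullMeasurableSet
    _ ≤ volume (A + T) := measure_mono (Set.iUnion₂_subset fun u hu =>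
        (hSsub u hu).trans (P.sector_subset Q hoA u))

lemma mem_ends (P : Polygon N A) {w a : Plane} (hw : ‖w‖ = 1) (hwN : w ∉ N) (ha : a ∈ A)
    (hmax : ∀ x ∈ A, inner ℝ w x ≤ inner ℝ w a) : a ∈ P.start '' N ∪ P.endpt '' N := by
  obtain ⟨u, hu, hface⟩ := P.exists_mem_face ha (notMem_interior_of_forall_inner_le hw hmax)
  rcases eq_or_ne a (P.start u) with h | h1
  · exact Or.inl ⟨u, hu, h.symm⟩
  rcases eq_or_ne a (P.endpt u) with h | h2
  · exact Or.inr ⟨u, hu, h.symm⟩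
  exfalso
  obtain ⟨s, hs, hsa⟩ := (P.mem_face_iff hu).1 hface
  have hs0 : 0 < s := lt_of_le_of_ne hs.1 fun h => h1 (by rw [← hsa, ← h]; simp)
  have hs1 : s < 1 := lt_of_le_of_ne hs.2 fun h => h2 (by rw [← hsa, h, endpt, one_mul])
  have hl : 0 < P.len u := lt_of_le_of_ne (P.len_nonneg u) fun h => h1 (by
    rw [← hsa, ← h]; simp)
  have m1 := hmax _ (P.start_mem hu).1
  have m2 := hmax _ (P.endpt_mem hu).1
  rw [← hsa, inner_add_right, inner_smul_right] at m1 m2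
  rw [endpt, inner_add_right, inner_smul_right] at m2
  have hin : inner ℝ w (rot u) = 0 := by
    have e1 : 0 ≤ s * P.len u * inner ℝ w (rot u) := by linarith
    have e2 : 0 ≤ (1 - s) * P.len u * -inner ℝ w (rot u) := by linarith
    have e3 := nonneg_of_mul_nonneg_right e1 (mul_pos hs0 hl)
    have e4 := nonneg_of_mul_nonneg_right e2 (mul_pos (sub_pos.2 hs1) hl)
    linarith
  have hrot0 : rot u ≠ 0 := norm_ne_zero_iff.1 (by
    rw [norm_rot (P.norm_eq u hu)]; exact one_ne_zero)
  refine hrot0 (eq_zero_of_inner_eq_zero (P.norm_eq u hu) hw ?_ ?_ (inner_rot_self u) hin)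
  · rintro rfl; exact hwN hu
  · rintro rfl
    obtain ⟨o, hoA, ho⟩ := P.exists_lt
    have e1 := hmax o hoA
    have e2 := ho _ hu
    have e3 := hface.2
    rw [inner_neg_left] at e2 e3
    linarith

theorem hausdorffMeasure_frontier_add_le (P : Polygon N A) (Q : Polygon N T) :
    μH[1] (frontier (A + T)) ≤ ENNReal.ofReal (P.per + Q.per) := by
  set V : Set Plane := (P.start '' N ∪ P.endpt '' N) + (Q.start '' N ∪ Q.endpt '' N) with hV
  have hVfin : V.Finite := by
    refine Set.Finite.add ?_ ?_ <;>
    exact (N.finite_toSet.image _).union (N.finite_toSet.image _)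
  have hconv : Convex ℝ (A + T) := P.convex.add Q.convex
  have hK_int : (interior (A + T)).Nonempty := by
    obtain ⟨x, hx⟩ := P.interior_nonempty
    obtain ⟨y, hy⟩ := Q.interior_nonempty
    exact ⟨x + y, subset_interior_add (Set.add_mem_add hx hy)⟩
  have hcover : frontier (A + T) ⊆ (⋃ u ∈ N, segment ℝ (P.start u + Q.start u)
      (P.start u + Q.start u + (P.len u + Q.len u) • rot u)) ∪ V := by
    intro k hk
    have hkAT : k ∈ A + T := (P.isCompact.add Q.isCompact).isClosed.frontier_subset hk
    obtain ⟨w, hw, hmax⟩ := exists_support hconv hK_int hk.2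
    obtain ⟨a, ha, t, ht, rfl⟩ := Set.mem_add.1 hkAT
    have ha' : ∀ x ∈ A, inner ℝ w x ≤ inner ℝ w a := fun x hx => by
      have := hmax _ (Set.add_mem_add hx ht)
      simpa [inner_add_right] using this
    have ht' : ∀ x ∈ T, inner ℝ w x ≤ inner ℝ w t := fun x hx => by
      have := hmax _ (Set.add_mem_add ha hx)
      simpa [inner_add_right] using this
    by_cases hwN : w ∈ N
    · left
      have hfa : a ∈ P.face w := ⟨ha, le_antisymm (P.inner_le hwN ha) (by
        rw [← (P.start_mem hwN).2]; exact ha' _ (P.start_mem hwN).1)⟩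
      have hft : t ∈ Q.face w := ⟨ht, le_antisymm (Q.inner_le hwN ht) (by
        rw [← (Q.start_mem hwN).2]; exact ht' _ (Q.start_mem hwN).1)⟩
      refine Set.mem_iUnion₂.2 ⟨w, hwN, ?_⟩
      obtain ⟨s, hs, rfl⟩ := (P.mem_face_iff hwN).1 hfa
      obtain ⟨m, hm, rfl⟩ := (Q.mem_face_iff hwN).1 hft
      have hlP := P.len_nonneg w
      have hlQ := Q.len_nonneg w
      have hmem : s * P.len w + m * Q.len w ∈ segment ℝ 0 (P.len w + Q.len w) := by
        rw [segment_eq_Icc (add_nonneg hlP hlQ)]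
        exact ⟨add_nonneg (mul_nonneg hs.1 hlP) (mul_nonneg hm.1 hlQ),
          add_le_add (mul_le_of_le_one_left hlP hs.2) (mul_le_of_le_one_left hlQ hm.2)⟩
      rw [segment_eq_image'] at hmem ⊢
      obtain ⟨θ, hθ, he⟩ := hmem
      refine ⟨θ, hθ, ?_⟩
      simp only [zero_add, sub_zero, smul_eq_mul] at he
      simp only [add_sub_cancel_left]
      rw [smul_smul, he, add_smul]
      abel
    · exact Or.inr (Set.add_mem_add (P.mem_ends hw hwN ha ha') (Q.mem_ends hw hwN ht ht'))
  have := Measure.nullSingletonClass_hausdorff Plane one_pos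
  refine (measure_mono hcover).trans ((measure_union_le _ _).trans ?_)
  rw [hVfin.measure_zero, add_zero]
  refine (measure_biUnion_finset_le _ _).trans ?_
  rw [per, per, ← Finset.sum_add_distrib, ENNReal.ofReal_sum_of_nonneg fun u _ =>
    add_nonneg (P.len_nonneg u) (Q.len_nonneg u)]
  exact Finset.sum_le_sum fun u hu => (hausdorffMeasure_segment_rot (P.norm_eq u hu) _
    (add_nonneg (P.len_nonneg u) (Q.len_nonneg u))).le

lemma perim_eq (P : Polygon N A) : perim A = P.per := by
  rw [perim, P.hausdorffMeasure_frontier, ENNReal.toReal_ofReal P.per_nonneg]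

/-- The cross-multiplied monotonicity of the information functional for polygons. -/
theorem area_mul_perim_add_le (P : Polygon N A) (Q : Polygon N T) :
    area A * perim (A + T) ≤ area (A + T) * perim A := by
  obtain ⟨o, hoA, r, hr, hro, hvol⟩ := P.exists_inradius
  have hA := P.per_nonneg
  have hT := Q.per_nonneg
  have h1 : area A ≤ r * P.per := ENNReal.toReal_le_of_le_ofReal (mul_nonneg hr.le hA) hvol
  have h2 : area A + r * Q.per ≤ area (A + T) := by
    have h := ENNReal.toReal_mono (P.isCompact.add Q.isCompact).measure_lt_top.ne
      (P.volume_add_ge Q hoA hr hro)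
    rwa [ENNReal.toReal_add P.isCompact.measure_lt_top.ne ENNReal.ofReal_ne_top,
      ENNReal.toReal_ofReal (mul_nonneg hr.le hT)] at h
  have h3 : perim (A + T) ≤ P.per + Q.per :=
    ENNReal.toReal_le_of_le_ofReal (add_nonneg hA hT) (P.hausdorffMeasure_frontier_add_le Q)
  rw [P.perim_eq]
  have h0 : 0 ≤ area A := ENNReal.toReal_nonneg
  calc area A * perim (A + T) ≤ area A * (P.per + Q.per) := by gcongr
    _ = area A * P.per + area A * Q.per := mul_add ..
    _ ≤ area A * P.per + r * P.per * Q.per := by gcongr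
    _ = (area A + r * Q.per) * P.per := by ring
    _ ≤ area (A + T) * P.per := by gcongr

end Polygon

/-! ### Approximation by circumscribed polygons -/

/-- The support function of a planar set. -/
noncomputable def suppFn (A : Set Plane) (u : Plane) : ℝ := sSup ((fun x => inner ℝ u x) '' A)

/-- The set circumscribed about `A` with outer normals in `N`. -/
def circumscribed (N : Finset Plane) (A : Set Plane) : Set Plane :=
  {x | ∀ u ∈ N, inner ℝ u x ≤ suppFn A u}

section Circumscribed

variable {A : Set Plane}

lemma inner_le_suppFn (hA : IsCompact A) (u : Plane) {x : Plane} (hx : x ∈ A) :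
    inner ℝ u x ≤ suppFn A u :=
  le_csSup (hA.image (by fun_prop)).bddAbove ⟨x, hx, rfl⟩

lemma exists_inner_eq_suppFn (hA : IsCompact A) (hne : A.Nonempty) (u : Plane) :
    ∃ x ∈ A, inner ℝ u x = suppFn A u :=
  (hA.image (f := fun x => inner ℝ u x) (by fun_prop)).sSup_mem (hne.image _)

lemma suppFn_pos (hA : IsCompact A) (h0 : 0 ∈ interior A) {u : Plane} (hu : ‖u‖ = 1) :
    0 < suppFn A u := by
  by_contra! h
  refine notMem_interior_of_forall_inner_le hu (fun x hx => ?_) h0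
  rw [inner_zero_right]
  exact (inner_le_suppFn hA u hx).trans h

lemma subset_circumscribed (hA : IsCompact A) (N : Finset Plane) : A ⊆ circumscribed N A :=
  fun _ hx u _ => inner_le_suppFn hA u hx

lemma circumscribed_anti {N N' : Finset Plane} (h : N ⊆ N') :
    circumscribed N' A ⊆ circumscribed N A :=
  fun _ hx u hu => hx u (h hu)

lemma convex_circumscribed (N : Finset Plane) (A : Set Plane) : Convex ℝ (circumscribed N A) := by
  intro x hx y hy a b ha hb hab u hu
  rw [inner_add_right, inner_smul_right, inner_smul_right]
  calc a * inner ℝ u x + b * inner ℝ u y ≤ a * suppFn A u + b * suppFn A u := by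
        gcongr
        · exact hx u hu
        · exact hy u hu
    _ = suppFn A u := by rw [← add_mul, hab, one_mul]

lemma isClosed_circumscribed (N : Finset Plane) (A : Set Plane) :
    IsClosed (circumscribed N A) := by
  have : circumscribed N A = ⋂ u ∈ N, {x : Plane | inner ℝ u x ≤ suppFn A u} := by
    ext x; simp [circumscribed]
  rw [this]
  exact isClosed_biInter fun u _ => isClosed_le (by fun_prop) continuous_const

lemma nonempty_polygon_circumscribed (hA : IsCompact A) (h0 : 0 ∈ interior A) {N : Finset Plane}
    (hN : ∀ u ∈ N, ‖u‖ = 1) {L : Set Plane} (hL : IsCompact L) (hsub : circumscribed N A ⊆ L) :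
    Nonempty (Polygon N (circumscribed N A)) := by
  have hc : IsCompact (circumscribed N A) :=
    hL.of_isClosed_subset (isClosed_circumscribed N A) hsub
  have hface : ∀ u : Plane, ∃ p : Plane, ∃ l : ℝ, 0 ≤ l ∧
      (u ∈ N → {x | x ∈ circumscribed N A ∧ inner ℝ u x = suppFn A u} =
        segment ℝ p (p + l • rot u)) := by
    intro u
    by_cases hu : u ∈ N
    · obtain ⟨x, hx, hxu⟩ := exists_inner_eq_suppFn hA ⟨0, interior_subset h0⟩ u
      obtain ⟨p, l, hl, h⟩ := exists_face_eq_segment (convex_circumscribed N A) hc (hN u hu)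
        ⟨x, subset_circumscribed hA N hx, hxu⟩
      exact ⟨p, l, hl, fun _ => h⟩
    · exact ⟨0, 0, le_rfl, fun h => absurd h hu⟩
  choose p l hl h using hface
  exact ⟨{
    supp := suppFn A
    start := p
    len := l
    isCompact := hc
    norm_eq := hN
    mem_iff := fun x => Iff.rfl
    exists_lt := ⟨0, subset_circumscribed hA N (interior_subset h0), fun u hu => by
      rw [inner_zero_right]; exact suppFn_pos hA h0 (hN u hu)⟩
    len_nonneg := hl
    face_eq := h }⟩

lemma exists_circumscribed_subset_smul (hA : Convex ℝ A) (hAc : IsCompact A)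
    (h0 : 0 ∈ interior A) {c : ℝ} (hc : 1 < c) :
    ∃ N : Finset Plane, (∀ u ∈ N, ‖u‖ = 1) ∧ circumscribed N A ⊆ c • A := by
  classical
  have hc0 : c ≠ 0 := by positivity
  have hLc : IsCompact (c • A) := hAc.smul c
  have h0L : (0 : Plane) ∈ interior (c • A) := by
    rw [interior_smul₀ hc0]
    exact ⟨0, h0, smul_zero c⟩
  have hsep : ∀ x ∈ frontier (c • A), ∃ u : Plane, ‖u‖ = 1 ∧ suppFn A u < inner ℝ u x := by
    intro x hx
    obtain ⟨u, hu, hmax⟩ := exists_support (hA.smul c) ⟨0, h0L⟩ hx.2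
    refine ⟨u, hu, ?_⟩
    obtain ⟨y, hy, hyu⟩ := exists_inner_eq_suppFn hAc ⟨0, interior_subset h0⟩ u
    have h1 := hmax _ (Set.smul_mem_smul_set hy)
    rw [inner_smul_right, hyu] at h1
    nlinarith [suppFn_pos hAc h0 hu]
  choose! f hf1 hf using hsep
  have hfrc : IsCompact (frontier (c • A)) :=
    hLc.of_isClosed_subset isClosed_frontier hLc.isClosed.frontier_subset
  obtain ⟨t, ht, hcover⟩ := hfrc.elim_nhds_subcover
    (fun x => {y : Plane | suppFn A (f x) < inner ℝ (f x) y})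
    fun x hx => (isOpen_lt continuous_const (by fun_prop)).mem_nhds (hf x hx)
  have hN : ∀ u ∈ t.image f, ‖u‖ = 1 := by
    intro u hu
    obtain ⟨x, hx, rfl⟩ := Finset.mem_image.1 hu
    exact hf1 x (ht x hx)
  refine ⟨t.image f, hN, ?_⟩
  have hdisj : Disjoint (interior (c • A)) (c • A)ᶜ :=
    disjoint_compl_right.mono_left interior_subset
  refine (IsPreconnected.subset_left_of_subset_union isOpen_interior
    hLc.isClosed.isOpen_compl hdisj (fun x hx => ?_)
    ⟨0, subset_circumscribed hAc _ (interior_subset h0), h0L⟩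
    (convex_circumscribed (t.image f) A).isPreconnected).trans interior_subset
  by_contra hx'
  rw [Set.mem_union, not_or, Set.mem_compl_iff, not_not] at hx'
  obtain ⟨y, hy, hxy⟩ := Set.mem_iUnion₂.1 (hcover ⟨subset_closure hx'.2, hx'.1⟩)
  exact absurd (hx _ (Finset.mem_image_of_mem f hy)) (not_le.2 hxy)

end Circumscribed

/-! ### Area and perimeter of convex bodies -/

lemma area_mono {K L : Set Plane} (hL : IsCompact L) (h : K ⊆ L) : area K ≤ area L :=
  ENNReal.toReal_mono hL.measure_lt_top.ne (measure_mono h)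

lemma area_smul (c : ℝ) (K : Set Plane) : area (c • K) = c ^ 2 * area K := by
  rw [area, Measure.addHaar_smul, finrank_euclideanSpace_fin, ENNReal.toReal_mul,
    ENNReal.toReal_ofReal (abs_nonneg _), abs_of_nonneg (by positivity), area]

lemma frontier_smul {c : ℝ} (hc : c ≠ 0) (K : Set Plane) : frontier (c • K) = c • frontier K :=
  ((Homeomorph.smulOfNeZero c hc).image_frontier K).symm

lemma hausdorffMeasure_frontier_smul {c : ℝ} (hc : 0 < c) (K : Set Plane) :
    μH[1] (frontier (c • K)) = ENNReal.ofReal c * μH[1] (frontier K) := by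
  rw [frontier_smul hc.ne', Measure.hausdorffMeasure_smul₀ zero_le_one hc.ne', NNReal.rpow_one,
    ENNReal.smul_def, smul_eq_mul, ← Real.enorm_of_nonneg hc.le]
  rfl

lemma perim_smul {c : ℝ} (hc : 0 < c) (K : Set Plane) : perim (c • K) = c * perim K := by
  rw [perim, hausdorffMeasure_frontier_smul hc, ENNReal.toReal_mul,
    ENNReal.toReal_ofReal hc.le, perim]

lemma hausdorffMeasure_frontier_ne_top {K : Set Plane} (hK : Convex ℝ K) (hKc : IsCompact K)
    (h0 : 0 ∈ interior K) : μH[1] (frontier K) ≠ ⊤ := by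
  obtain ⟨N, hN, hsub⟩ := exists_circumscribed_subset_smul hK hKc h0 one_lt_two
  obtain ⟨P⟩ := nonempty_polygon_circumscribed hKc h0 hN (hKc.smul 2) hsub
  refine ne_top_of_le_ne_top ?_ (hausdorffMeasure_frontier_mono hK hKc ⟨0, h0⟩ P.isCompact
    (subset_circumscribed hKc N))
  rw [P.hausdorffMeasure_frontier]
  exact ENNReal.ofReal_ne_top

lemma perim_mono {K L : Set Plane} (hK : Convex ℝ K) (hKc : IsCompact K) (hK0 : 0 ∈ interior K)
    (hL : Convex ℝ L) (hLc : IsCompact L) (h : K ⊆ L) : perim K ≤ perim L :=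
  ENNReal.toReal_mono (hausdorffMeasure_frontier_ne_top hL hLc (interior_mono h hK0))
    (hausdorffMeasure_frontier_mono hK hKc ⟨0, hK0⟩ hLc h)

lemma zero_mem_interior_add {A T : Set Plane} (hA : 0 ∈ interior A) (hT : 0 ∈ interior T) :
    (0 : Plane) ∈ interior (A + T) :=
  subset_interior_add (add_zero (0 : Plane) ▸ Set.add_mem_add hA hT)

theorem area_mul_perim_add_le {A T : Set Plane} (hA : Convex ℝ A) (hAc : IsCompact A)
    (hA0 : 0 ∈ interior A) (hT : Convex ℝ T) (hTc : IsCompact T) (hT0 : 0 ∈ interior T) :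
    area A * perim (A + T) ≤ area (A + T) * perim A := by
  classical
  have key : ∀ c : ℝ, 1 < c →
      area A * perim (A + T) ≤ c ^ 3 * (area (A + T) * perim A) := by
    intro c hc
    have hc0 : 0 < c := one_pos.trans hc
    obtain ⟨N₁, hN₁, hs₁⟩ := exists_circumscribed_subset_smul hA hAc hA0 hc
    obtain ⟨N₂, hN₂, hs₂⟩ := exists_circumscribed_subset_smul hT hTc hT0 hc
    have hN : ∀ u ∈ N₁ ∪ N₂, ‖u‖ = 1 := fun u hu =>
      (Finset.mem_union.1 hu).elim (hN₁ u) (hN₂ u)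
    set N := N₁ ∪ N₂
    replace hs₁ := (circumscribed_anti (A := A) (N' := N) Finset.subset_union_left).trans hs₁
    replace hs₂ := (circumscribed_anti (A := T) (N' := N) Finset.subset_union_right).trans hs₂
    obtain ⟨P⟩ := nonempty_polygon_circumscribed hAc hA0 hN (hAc.smul c) hs₁
    obtain ⟨Q⟩ := nonempty_polygon_circumscribed hTc hT0 hN (hTc.smul c) hs₂
    have hAP := subset_circumscribed hAc N
    have hTQ := subset_circumscribed hTc N
    set A' := circumscribed N A
    set T' := circumscribed N T
    have h1 : area A ≤ area A' := area_mono P.isCompact hAP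
    have h2 : perim (A + T) ≤ perim (A' + T') :=
      perim_mono (hA.add hT) (hAc.add hTc) (zero_mem_interior_add hA0 hT0)
        (P.convex.add Q.convex) (P.isCompact.add Q.isCompact) (Set.add_subset_add hAP hTQ)
    have h3 : area (A' + T') ≤ c ^ 2 * area (A + T) := by
      rw [← area_smul c, smul_add]
      exact area_mono ((hAc.smul c).add (hTc.smul c)) (Set.add_subset_add hs₁ hs₂)
    have h4 : perim A' ≤ c * perim A := by
      rw [← perim_smul hc0]
      exact perim_mono P.convex P.isCompact (interior_mono hAP hA0) (hA.smul c) (hAc.smul c) hs₁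
    calc area A * perim (A + T) ≤ area A' * perim (A' + T') :=
          mul_le_mul h1 h2 ENNReal.toReal_nonneg ENNReal.toReal_nonneg
      _ ≤ area (A' + T') * perim A' := P.area_mul_perim_add_le Q
      _ ≤ (c ^ 2 * area (A + T)) * (c * perim A) :=
          mul_le_mul h3 h4 ENNReal.toReal_nonneg
            (mul_nonneg (sq_nonneg c) ENNReal.toReal_nonneg)
      _ = _ := by ring
  have hlim : Filter.Tendsto (fun c : ℝ => c ^ 3 * (area (A + T) * perim A))
      (nhdsWithin 1 (Set.Ioi 1)) (nhds (1 ^ 3 * (area (A + T) * perim A))) :=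
    ((by fun_prop : Continuous fun c : ℝ => c ^ 3 * (area (A + T) * perim A)).tendsto
      1).mono_left nhdsWithin_le_nhds
  rw [one_pow, one_mul] at hlim
  exact ge_of_tendsto hlim (Filter.eventually_of_mem self_mem_nhdsWithin key)

theorem info_le_info_add {A T : Set Plane} (hA : Convex ℝ A) (hAc : IsCompact A)
    (hA0 : 0 ∈ interior A) (hT : Convex ℝ T) (hTc : IsCompact T) (hT0 : 0 ∈ interior T) :
    info A ≤ info (A + T) := by
  have hle : perim A ≤ perim (A + T) :=
    perim_mono hA hAc hA0 (hA.add hT) (hAc.add hTc) fun a ha =>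
      add_zero a ▸ Set.add_mem_add ha (interior_subset hT0)
  have hnonneg : 0 ≤ info (A + T) := div_nonneg ENNReal.toReal_nonneg ENNReal.toReal_nonneg
  rcases (show 0 ≤ perim A from ENNReal.toReal_nonneg).eq_or_lt with h | h
  · rwa [info, ← h, div_zero]
  · rw [info, info, div_le_div_iff₀ h (h.trans_le hle)]
    exact area_mul_perim_add_le hA hAc hA0 hT hTc hT0

lemma info_vadd (x : Plane) (K : Set Plane) : info (x +ᵥ K) = info K := by
  have h : frontier (x +ᵥ K) = x +ᵥ frontier K := ((Homeomorph.vadd x).image_frontier K).symm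
  rw [info, info, area, area, perim, perim, h, measure_vadd, hausdorffMeasure_vadd]
  exact Or.inl zero_le_one

end PlanarConvex

/-- In the plane the information functional is monotone under Minkowski addition. -/
theorem info_monotone_plane
    {A T : Set (EuclideanSpace ℝ (Fin 2))}
    (hA : Convex ℝ A) (hAc : IsCompact A) (hAint : (interior A).Nonempty)
    (hT : Convex ℝ T) (hTc : IsCompact T) (hTint : (interior T).Nonempty) :
    info (A + T) ≥ info A := by
  obtain ⟨a, ha⟩ := hAint
  obtain ⟨t, ht⟩ := hTint
  have ha0 : 0 ∈ interior (-a +ᵥ A) := by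
    rw [interior_vadd]
    exact ⟨a, ha, neg_add_cancel a⟩
  have ht0 : 0 ∈ interior (-t +ᵥ T) := by
    rw [interior_vadd]
    exact ⟨t, ht, neg_add_cancel t⟩
  have h := PlanarConvex.info_le_info_add (hA.vadd (-a)) (hAc.vadd (-a)) ha0
    (hT.vadd (-t)) (hTc.vadd (-t)) ht0
  have hsum : (-a +ᵥ A) + (-t +ᵥ T) = (-a + -t) +ᵥ (A + T) := by
    rw [vadd_add_vadd_comm]
  rwa [hsum, PlanarConvex.info_vadd, PlanarConvex.info_vadd] at h
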